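/- Let k be a field of characteristic different from 2, a, b ∈ k*, Q = (a,b)_k the quaternion algebra with conjugation x ↦ x̄ and norm form N_Q, and H ∈ GLₙ(Q) an invertible hermitian matrix. Then there exist a₁, …, aₙ ∈ k* such that the trace form q_H is isometric over k to N_Q ⊗ ⟨a₁, …, aₙ⟩. -/

import Mathlib

open Matrix Quaternion

/-- A nonzero quaternion is detected by the trace pairing `(q, p) ↦ trd (q̄ p)`. -/
theorem QuaternionAlgebra.eq_zero_of_trace_mul_eq_zero {k : Type*} [Field k] (h2 : (2 : k) ≠ 0)
    {a b : k} (ha : a ≠ 0) (hb : b ≠ 0) (p : ℍ[k, a, b])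
    (h : ∀ q : ℍ[k, a, b], star q * p + star p * q = 0) : p = 0 := by
  have h1 := congrArg QuaternionAlgebra.re (h ⟨1, 0, 0, 0⟩)
  have hi := congrArg QuaternionAlgebra.re (h ⟨0, 1, 0, 0⟩)
  have hj := congrArg QuaternionAlgebra.re (h ⟨0, 0, 1, 0⟩)
  have hk := congrArg QuaternionAlgebra.re (h ⟨0, 0, 0, 1⟩)
  simp at h1 hi hj hk
  ext
  · have : 2 * p.re = 0 := by linear_combination h1
    simpa [h2] using this
  · have : 2 * a * p.imI = 0 := by linear_combination -hi
    simpa [h2, ha] using this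
  · have : 2 * b * p.imJ = 0 := by linear_combination -hj
    simpa [h2, hb] using this
  · have : 2 * a * b * p.imK = 0 := by linear_combination hk
    simpa [h2, ha, hb] using this

theorem QuaternionAlgebra.finrank_pi {k : Type*} [Field k] (a b : k) (m : ℕ) :
    Module.finrank k (Fin m → ℍ[k, a, b]) = m * 4 := by
  rw [Module.finrank_pi_fintype]
  simp [QuaternionAlgebra.finrank_eq_four]

/-- The `k`-linear map sending `(qᵢ)` to the right linear combination `∑ vᵢ qᵢ`. -/
def QuaternionAlgebra.rightCombination {k : Type*} [Field k] {a b : k} {m n : ℕ}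
    (v : Fin m → Fin n → ℍ[k, a, b]) : (Fin m → ℍ[k, a, b]) →ₗ[k] (Fin n → ℍ[k, a, b]) where
  toFun q := ∑ i, MulOpposite.op (q i) • v i
  map_add' p q := by simp [add_smul, Finset.sum_add_distrib]
  map_smul' r q := by simp [Finset.smul_sum, smul_assoc]

namespace Matrix

variable {R : Type*} [Ring R] [StarRing R] {n : ℕ}

/-- The sesquilinear form `x̄ᵀ H y` attached to a square matrix. -/
def sesqForm (H : Matrix (Fin n) (Fin n) R) (x y : Fin n → R) : R :=
  star x ⬝ᵥ H *ᵥ y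

variable (H : Matrix (Fin n) (Fin n) R)

theorem sesqForm_add_left (x y z : Fin n → R) :
    H.sesqForm (x + y) z = H.sesqForm x z + H.sesqForm y z := by
  simp [sesqForm, add_dotProduct]

theorem sesqForm_add_right (x y z : Fin n → R) :
    H.sesqForm x (y + z) = H.sesqForm x y + H.sesqForm x z := by
  simp [sesqForm, mulVec_add, dotProduct_add]

theorem sesqForm_sub_right (x y z : Fin n → R) :
    H.sesqForm x (y - z) = H.sesqForm x y - H.sesqForm x z := by
  simp [sesqForm, mulVec_sub, dotProduct_sub]

theorem sesqForm_op_smul_right (x y : Fin n → R) (q : R) :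
    H.sesqForm x (MulOpposite.op q • y) = H.sesqForm x y * q := by
  simp [sesqForm, mulVec_smul, dotProduct_smul]

theorem sesqForm_sum_right {ι : Type*} (s : Finset ι) (x : Fin n → R) (y : ι → Fin n → R) :
    H.sesqForm x (∑ i ∈ s, y i) = ∑ i ∈ s, H.sesqForm x (y i) :=
  map_sum (AddMonoidHom.mk' (H.sesqForm x) (H.sesqForm_add_right x)) y s

theorem sesqForm_rightCombination {k : Type*} [Field k] {a b : k} {m : ℕ}
    (H : Matrix (Fin n) (Fin n) ℍ[k, a, b]) (v : Fin m → Fin n → ℍ[k, a, b])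
    (x : Fin n → ℍ[k, a, b]) (q : Fin m → ℍ[k, a, b]) :
    H.sesqForm x (QuaternionAlgebra.rightCombination v q) = ∑ i, H.sesqForm x (v i) * q i := by
  simp only [QuaternionAlgebra.rightCombination, LinearMap.coe_mk, AddHom.coe_mk,
    sesqForm_sum_right, sesqForm_op_smul_right]

variable {H}

theorem IsHermitian.star_sesqForm (hH : H.IsHermitian) (x y : Fin n → R) :
    star (H.sesqForm x y) = H.sesqForm y x := by
  rw [sesqForm, sesqForm, ← star_dotProduct, star_mulVec, hH.eq, dotProduct_mulVec]

theorem eq_zero_of_sesqForm_right (hH : IsUnit H) {y : Fin n → R}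
    (h : ∀ x, H.sesqForm x y = 0) : y = 0 := by
  have hy : H *ᵥ y = 0 := by
    ext i
    have := h (Pi.single i 1)
    simpa [sesqForm, ← Pi.single_star] using this
  obtain ⟨u, rfl⟩ := hH
  have : (↑u⁻¹ : Matrix (Fin n) (Fin n) R) *ᵥ (↑u : Matrix (Fin n) (Fin n) R) *ᵥ y = 0 := by
    rw [hy, mulVec_zero]
  simpa [mulVec_mulVec] using this

/-- A nondegenerate hermitian form over a quaternion algebra has, in the orthogonal complement of
fewer than `n` orthogonal anisotropic vectors, another anisotropic vector. -/
theorem exists_sesqForm_self_ne_zero_of_orthogonal {k : Type*} [Field k] (h2 : (2 : k) ≠ 0)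
    {a b : k} (ha : a ≠ 0) (hb : b ≠ 0) {H : Matrix (Fin n) (Fin n) ℍ[k, a, b]}
    (hH : H.IsHermitian) (hu : IsUnit H) {m : ℕ} (hm : m < n)
    (v : Fin m → Fin n → ℍ[k, a, b]) (c : Fin m → k) (hc : ∀ i, c i ≠ 0)
    (hv : ∀ i j, H.sesqForm (v i) (v j) = if i = j then (c i : ℍ[k, a, b]) else 0) :
    ∃ x, (∀ i, H.sesqForm (v i) x = 0) ∧ H.sesqForm x x ≠ 0 := by
  let φ := QuaternionAlgebra.rightCombination v
  let proj (y : Fin n → ℍ[k, a, b]) : Fin n → ℍ[k, a, b] :=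
    y - φ fun i => (((c i)⁻¹ : k) : ℍ[k, a, b]) * H.sesqForm (v i) y
  have hproj (y) (i) : H.sesqForm (v i) (proj y) = 0 := by
    simp only [proj, φ, sesqForm_sub_right, sesqForm_rightCombination, hv, ite_mul, zero_mul,
      Finset.sum_ite_eq, Finset.mem_univ, if_true]
    rw [← mul_assoc, ← QuaternionAlgebra.coe_mul, mul_inv_cancel₀ (hc i)]
    simp
  have hφ : ¬ Function.Surjective φ := fun hs => by
    have := LinearMap.finrank_le_finrank_of_surjective hs
    rw [QuaternionAlgebra.finrank_pi, QuaternionAlgebra.finrank_pi] at this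
    omega
  obtain ⟨y, hy⟩ := not_forall.1 hφ
  have hw0 : proj y ≠ 0 := fun h => hy ⟨_, (sub_eq_zero.1 h).symm⟩
  obtain ⟨z, hz⟩ : ∃ z, H.sesqForm z (proj y) ≠ 0 := by
    by_contra! h
    exact hw0 (eq_zero_of_sesqForm_right hu h)
  have hwz : H.sesqForm (proj y) (proj z) ≠ 0 := by
    have h0 (i) : H.sesqForm (proj y) (v i) = 0 := by
      rw [← hH.star_sesqForm, hproj, star_zero]
    have : H.sesqForm (proj y) (proj z) = H.sesqForm (proj y) z := by
      change H.sesqForm (proj y) (z - φ _) = _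
      simp only [φ, sesqForm_sub_right, sesqForm_rightCombination, h0, zero_mul,
        Finset.sum_const_zero, sub_zero]
    rw [this, ← hH.star_sesqForm]
    simpa using hz
  by_contra! h
  refine hwz (QuaternionAlgebra.eq_zero_of_trace_mul_eq_zero h2 ha hb _ fun q => ?_)
  have hq (i) : H.sesqForm (v i) (MulOpposite.op q • proj y) = 0 := by
    rw [sesqForm_op_smul_right, hproj, zero_mul]
  have e := h (MulOpposite.op q • proj y + proj z) fun i => by
    rw [sesqForm_add_right, hq, hproj, add_zero]
  rw [sesqForm_add_left, sesqForm_add_right, sesqForm_add_right, h _ hq, h _ (hproj z), zero_add,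
    add_zero, ← hH.star_sesqForm, sesqForm_op_smul_right, star_mul, hH.star_sesqForm] at e
  rwa [hH.star_sesqForm]

/-- A nondegenerate hermitian form over a quaternion algebra with scalar values on the diagonal
admits orthogonal anisotropic families of every size up to `n`. -/
theorem exists_orthogonal_sesqForm {k : Type*} [Field k] (h2 : (2 : k) ≠ 0)
    {a b : k} (ha : a ≠ 0) (hb : b ≠ 0) {H : Matrix (Fin n) (Fin n) ℍ[k, a, b]}
    (hH : H.IsHermitian) (hu : IsUnit H)
    (hk : ∀ x, ∃ r : k, H.sesqForm x x = r) {m : ℕ} (hm : m ≤ n) :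
    ∃ (v : Fin m → Fin n → ℍ[k, a, b]) (c : Fin m → k), (∀ i, c i ≠ 0) ∧
      ∀ i j, H.sesqForm (v i) (v j) = if i = j then (c i : ℍ[k, a, b]) else 0 := by
  induction m with
  | zero => exact ⟨Fin.elim0, Fin.elim0, fun i => i.elim0, fun i => i.elim0⟩
  | succ m ih =>
    obtain ⟨v, c, hc, hv⟩ := ih (by omega)
    obtain ⟨x, hx, hxx⟩ := exists_sesqForm_self_ne_zero_of_orthogonal h2 ha hb hH hu hm v c hc hv
    obtain ⟨r, hr⟩ := hk x
    have hx' (i) : H.sesqForm x (v i) = 0 := by rw [← hH.star_sesqForm, hx, star_zero]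
    refine ⟨Fin.cons x v, Fin.cons r c, Fin.cases ?_ hc, Fin.cases ?_ fun i => ?_⟩
    · rintro rfl
      exact hxx hr
    · refine Fin.cases ?_ fun j => ?_
      · simp [hr]
      · simp [hx', (Fin.succ_ne_zero j).symm]
    · refine Fin.cases ?_ fun j => ?_
      · simp [hx]
      · simp [hv]

end Matrix

/-- Tensoring with the diagonal form `⟨c₁, …, cₙ⟩` is the orthogonal sum of the scalings by `cᵢ`. -/
theorem QuadraticForm.tmul_weightedSumSquares_equivalent_pi {k M : Type*} [Field k]
    [Invertible (2 : k)] [AddCommGroup M] [Module k M] {n : ℕ} (N : QuadraticForm k M)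
    (c : Fin n → k) :
    (N.tmul (QuadraticMap.weightedSumSquares k c)).Equivalent
      (QuadraticMap.pi fun i => c i • N) := by
  refine ⟨⟨TensorProduct.piScalarRight k k M (Fin n), fun t => ?_⟩⟩
  have key : (QuadraticMap.pi fun i => c i • N).comp
      (TensorProduct.piScalarRight k k M (Fin n)).toLinearMap =
      N.tmul (QuadraticMap.weightedSumSquares k c) := by
    apply (QuadraticMap.associated_rightInverse k).injective
    rw [QuadraticForm.associated_tmul]
    refine TensorProduct.ext' fun x v => TensorProduct.ext' fun y w => ?_
    have hW : (QuadraticMap.weightedSumSquares k c).associated v w =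
        ∑ i, c i * (v i * w i) := by
      simp only [QuadraticMap.associated_apply, QuadraticMap.weightedSumSquares_apply,
        ← Finset.sum_sub_distrib, smul_eq_mul, Finset.mul_sum, Pi.add_apply, Module.End.smul_def,
        QuadraticMap.half_moduleEnd_apply_eq_half_smul]
      refine Finset.sum_congr rfl fun i _ => ?_
      linear_combination (c i * v i * w i) * invOf_mul_self (2 : k)
    have hpi : (QuadraticMap.pi fun i => c i • N).associated
        (TensorProduct.piScalarRight k k M (Fin n) (x ⊗ₜ v))
        (TensorProduct.piScalarRight k k M (Fin n) (y ⊗ₜ w)) =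
        ∑ i, c i * (v i * w i) * N.associated x y := by
      simp only [QuadraticMap.associated_apply, QuadraticMap.pi_apply, smul_eq_mul,
        ← Finset.sum_sub_distrib, Finset.mul_sum, Pi.add_apply, Module.End.smul_def,
        QuadraticMap.half_moduleEnd_apply_eq_half_smul, TensorProduct.piScalarRight_apply,
        TensorProduct.piScalarRightHom_tmul, _root_.smul_apply]
      refine Finset.sum_congr rfl fun i _ => ?_
      simp only [QuadraticMap.map_add N, QuadraticMap.polar_smul_left,
        QuadraticMap.polar_smul_right, smul_eq_mul]
      ring
    rw [LinearMap.BilinForm.tensorDistrib_tmul, QuadraticMap.associated_comp,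
      hW, smul_eq_mul, Finset.sum_mul]
    exact hpi
  exact DFunLike.congr_fun key t

/-- Let `k` be a field of characteristic ≠ 2 (2 is invertible), `Q = (a,b)_k` a
quaternion algebra with its standard conjugation `star` and norm form `N` (the `k`-quadratic
form on `Q` with `N x = x * x̄ ∈ k·1`), and `H` an invertible hermitian `n × n` matrix over `Q`
with trace form `q_H` (the `k`-quadratic form on `Qⁿ` with `q_H x = x̄ᵀ H x ∈ k·1`).  Then there
are `a₁, …, aₙ ∈ k*` such that `q_H` is isometric over `k` to `N ⊗ ⟨a₁, …, aₙ⟩`. -/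
theorem quaternion_trace_form_eq_norm_tensor_diagonal
    (k : Type) [Field k] [Invertible (2 : k)]
    (a b : k) (ha : a ≠ 0) (hb : b ≠ 0)
    (n : ℕ) (H : Matrix (Fin n) (Fin n) ℍ[k, a, b])
    (hHherm : Hᴴ = H) (hHunit : IsUnit H)
    (qH : QuadraticForm k (Fin n → ℍ[k, a, b]))
    (hqH : ∀ x : Fin n → ℍ[k, a, b],
      algebraMap k ℍ[k, a, b] (qH x) = ∑ i, star (x i) * H.mulVec x i)
    (N : QuadraticForm k ℍ[k, a, b])
    (hN : ∀ x : ℍ[k, a, b], algebraMap k ℍ[k, a, b] (N x) = x * star x) :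
    ∃ c : Fin n → k, (∀ i, c i ≠ 0) ∧
      qH.Equivalent (N.tmul (QuadraticMap.weightedSumSquares k c)) := by
  have h2 : (2 : k) ≠ 0 := Invertible.ne_zero 2
  obtain ⟨v, c, hc, hv⟩ := Matrix.exists_orthogonal_sesqForm h2 ha hb hHherm hHunit
    (fun x => ⟨qH x, (hqH x).symm⟩) le_rfl
  refine ⟨c, hc, QuadraticMap.Equivalent.symm <|
    (QuadraticForm.tmul_weightedSumSquares_equivalent_pi N c).trans ?_⟩
  let φ := QuaternionAlgebra.rightCombination v
  have hφ (q) (i) : H.sesqForm (v i) (φ q) = c i * q i := by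
    simp [φ, Matrix.sesqForm_rightCombination, hv]
  have hinj : Function.Injective φ := by
    refine (injective_iff_map_eq_zero φ).2 fun q hq => funext fun i => ?_
    have := hφ q i
    rw [hq] at this
    simpa [Matrix.sesqForm, ← QuaternionAlgebra.smul_coe, QuaternionAlgebra.coe_mul_eq_smul, hc]
      using this.symm
  refine ⟨⟨LinearEquiv.ofInjectiveEndo φ hinj, fun q => ?_⟩⟩
  apply QuaternionAlgebra.coe_injective (c₁ := a) (c₂ := 0) (c₃ := b)
  refine (hqH _).trans ?_
  change H.sesqForm (φ q) (φ q) = _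
  have hqs (i) : H.sesqForm (φ q) (v i) = star (q i) * c i := by
    rw [← Matrix.IsHermitian.star_sesqForm hHherm, hφ]
    simp
  have hNq (i) : star (q i) * c i * q i = ((c i * N (q i) : k) : ℍ[k, a, b]) := by
    rw [QuaternionAlgebra.coe_mul, ← QuaternionAlgebra.coe_commutes, mul_assoc, star_comm_self',
      ← hN, QuaternionAlgebra.coe_algebraMap]
  rw [Matrix.sesqForm_rightCombination]
  simp only [hqs, hNq, QuadraticMap.pi_apply, _root_.smul_apply, smul_eq_mul]
  exact (map_sum (algebraMap k ℍ[k, a, b]) _ _).symm
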